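/- Coercivity of the parameter gradient of the energy (Lemma 3.8): Define the parameter-space energy ℰ(m, C) = E_{ε∼N(0,I)}[ U(Cε + m) ] for (m,C) ∈ ℝ^d × ℝ^{d×d}; ℰ is Fréchet differentiable with gradient ∇ℰ(m,C) = ( E_ε[∇U(Cε + m)], E_ε[∇U(Cε + m)·εᵀ] ). Let λ_* = (m_*, C_*) ∈ Λ be a minimizer over Λ of the free energy F(m,C) = ℰ(m,C) − Σ_{i=1}^d log(C_{ii}) − (d/2)·log(2πe). Then for every λ = (m,C) ∈ Λ: ⟨ ∇ℰ(λ) − ∇ℰ(λ_*), λ − λ_* ⟩ ≥ (μ/2)·‖λ − λ_*‖² + ( ℰ(λ) − ℰ(λ_*) − ⟨ ∇ℰ(λ_*), λ − λ_* ⟩ ), where the inner product on parameters is ⟨(m,C),(m',C')⟩ = ⟨m,m'⟩ + tr(CᵀC'). -/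

import Mathlib

open MeasureTheory Matrix Real
open scoped RealInnerProductSpace

noncomputable section

/-- `ℝ^d` as a Euclidean space. -/
abbrev Vec (d : ℕ) := EuclideanSpace ℝ (Fin d)

/-- `d × d` real matrices. -/
abbrev Mat (d : ℕ) := Matrix (Fin d) (Fin d) ℝ

variable {d : ℕ}

/-- Matrix-vector product as a map on Euclidean space. -/
def matVec (A : Mat d) (x : Vec d) : Vec d :=
  (EuclideanSpace.equiv (Fin d) ℝ).symm (A.mulVec (EuclideanSpace.equiv (Fin d) ℝ x))

/-- The Gaussian measure `N(m, S)` on `ℝ^d` with mean `m` and covariance `S`,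
defined via its density with respect to Lebesgue measure.  (For `S` positive
definite this is the usual Gaussian probability measure.) -/
def gaussian (m : Vec d) (S : Mat d) : Measure (Vec d) :=
  volume.withDensity fun x =>
    ENNReal.ofReal (Real.sqrt (((2 * π) ^ d * S.det)⁻¹) *
      Real.exp (-⟪x - m, matVec S⁻¹ (x - m)⟫ / 2))

/-- The Hessian of `f : ℝ^d → ℝ` at `x`, as a `d × d` matrix. -/
def hess (f : Vec d → ℝ) (x : Vec d) : Mat d :=
  Matrix.of fun i j =>
    fderiv ℝ (fun y => fderiv ℝ f y (EuclideanSpace.single j 1)) x (EuclideanSpace.single i 1)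

/-- Frobenius norm of a matrix. -/
def frobNorm (A : Mat d) : ℝ := Real.sqrt (∑ i, ∑ j, (A i j) ^ 2)

/-- Squared Frobenius norm of a matrix. -/
def frobSq (A : Mat d) : ℝ := ∑ i, ∑ j, (A i j) ^ 2

/-- Jacobian of `g : ℝ^d → ℝ^d` at `x`: `(jacobian g x) i j = ∂ g_j / ∂ x_i`. -/
def jacobian (g : Vec d → Vec d) (x : Vec d) : Mat d :=
  Matrix.of fun i j => fderiv ℝ (fun y => g y j) x (EuclideanSpace.single i 1)

/-- Membership in the parameter space `Λ`: `C` is lower triangular with strictly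
positive diagonal. -/
def memLambda (m : Vec d) (C : Mat d) : Prop :=
  (∀ i j : Fin d, i < j → C i j = 0) ∧ ∀ i, 0 < C i i

/-- The parameter-space energy `ℰ(m, C) = E_{ε∼N(0,I)}[U(Cε + m)]`. -/
def energyP (U : Vec d → ℝ) (m : Vec d) (C : Mat d) : ℝ :=
  ∫ e, U (matVec C e + m) ∂(gaussian (0 : Vec d) (1 : Mat d))

/-- Location component of the gradient of the energy: `E_ε[∇U(Cε + m)]`. -/
def paramGradM (U : Vec d → ℝ) (m : Vec d) (C : Mat d) : Vec d :=
  ∫ e, gradient U (matVec C e + m) ∂(gaussian (0 : Vec d) (1 : Mat d))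

/-- Scale component of the gradient of the energy: `E_ε[∇U(Cε + m)·εᵀ]`. -/
def paramGradC (U : Vec d → ℝ) (m : Vec d) (C : Mat d) : Mat d :=
  Matrix.of fun i j =>
    ∫ e, gradient U (matVec C e + m) i * e j ∂(gaussian (0 : Vec d) (1 : Mat d))

/-- The parameter-space free energy
`F(m,C) = ℰ(m,C) − Σᵢ log(Cᵢᵢ) − (d/2)·log(2πe)`. -/
def paramF (U : Vec d → ℝ) (m : Vec d) (C : Mat d) : ℝ :=
  energyP U m C - (∑ i, Real.log (C i i)) - ((d : ℝ) / 2) * Real.log (2 * π * Real.exp 1)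

theorem gaussian_zero_one_eq_smul_exp :
    gaussian (0 : Vec d) (1 : Mat d) = volume.withDensity fun x =>
      ENNReal.ofReal (Real.sqrt (((2 * π) ^ d)⁻¹) * Real.exp (-(1 / 2) * ‖x‖ ^ 2)) := by
  unfold gaussian
  congr 1
  ext x
  have : matVec (1 : Mat d) x = x := by simp [matVec]
  simp only [det_one, mul_one, sub_zero, inv_one, this, real_inner_self_eq_norm_sq]
  congr 3
  ring

instance isFiniteMeasure_gaussian_zero_one :
    IsFiniteMeasure (gaussian (0 : Vec d) (1 : Mat d)) := by
  rw [gaussian_zero_one_eq_smul_exp]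
  have h := GaussianFourier.integrable_cexp_neg_mul_sq_norm_add (V := Vec d)
    (b := ((1 / 2 : ℝ) : ℂ)) (by norm_num) 0 0
  refine isFiniteMeasure_withDensity_ofReal (Integrable.hasFiniteIntegral ?_)
  refine (h.re.const_mul (Real.sqrt (((2 * π) ^ d)⁻¹))).congr (.of_forall fun x => ?_)
  simp only [zero_mul, add_zero]
  congr 1
  rw [← Complex.exp_ofReal_re]
  push_cast
  rfl

theorem gaussian_zero_one_eq_stdGaussian :
    gaussian (0 : Vec d) (1 : Mat d) = ProbabilityTheory.stdGaussian (Vec d) := by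
  refine Measure.ext_of_charFun (funext fun t => ?_)
  rw [ProbabilityTheory.charFun_stdGaussian, charFun_apply, gaussian_zero_one_eq_smul_exp,
    integral_withDensity_eq_integral_toReal_smul (by fun_prop) (.of_forall fun _ => ENNReal.ofReal_lt_top)]
  have hc : ((Real.sqrt (((2 * π) ^ d)⁻¹) : ℝ) : ℂ) * (π / ((1 / 2 : ℝ) : ℂ)) ^
      (Module.finrank ℝ (Vec d) / 2 : ℂ) = 1 := by
    have : (π / ((1 / 2 : ℝ) : ℂ)) ^ (Module.finrank ℝ (Vec d) / 2 : ℂ) =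
        ((Real.sqrt ((2 * π) ^ d) : ℝ) : ℂ) := by
      rw [finrank_euclideanSpace_fin, Real.sqrt_eq_rpow, ← Real.rpow_natCast,
        ← Real.rpow_mul (by positivity), Complex.ofReal_cpow (by positivity)]
      push_cast
      congr 1 <;> ring
    rw [this, Real.sqrt_inv, ← Complex.ofReal_mul, inv_mul_cancel₀ (by positivity)]
    simp
  have h := GaussianFourier.integral_cexp_neg_mul_sq_norm_add (V := Vec d)
    (b := ((1 / 2 : ℝ) : ℂ)) (by norm_num) Complex.I t
  calc _ = ∫ x : Vec d, ((Real.sqrt (((2 * π) ^ d)⁻¹) : ℝ) : ℂ) *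
          Complex.exp (-((1 / 2 : ℝ) : ℂ) * ‖x‖ ^ 2 + Complex.I * ⟪t, x⟫) := by
        refine integral_congr_ae (.of_forall fun x => ?_)
        dsimp only
        rw [ENNReal.toReal_ofReal (by positivity), Complex.exp_add, real_inner_comm,
          Complex.real_smul]
        push_cast
        rw [mul_comm Complex.I]
        ring
    _ = _ := by
        rw [integral_const_mul, h, ← mul_assoc, hc, one_mul]
        congr 1
        rw [Complex.I_sq]
        push_cast
        ring

instance isGaussian_gaussian_zero_one :
    ProbabilityTheory.IsGaussian (gaussian (0 : Vec d) (1 : Mat d)) := by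
  rw [gaussian_zero_one_eq_stdGaussian]
  infer_instance

theorem integral_coord_gaussian_zero_one (i : Fin d) :
    ∫ e : Vec d, e i ∂(gaussian (0 : Vec d) (1 : Mat d)) = 0 := by
  rw [gaussian_zero_one_eq_stdGaussian]
  exact ProbabilityTheory.integral_strongDual_stdGaussian (EuclideanSpace.proj i)

theorem memLp_coord_gaussian_zero_one (i : Fin d) :
    MemLp (fun e : Vec d => e i) 2 (gaussian (0 : Vec d) (1 : Mat d)) :=
  ProbabilityTheory.IsGaussian.memLp_two_id.eval_piLp i

theorem integral_coord_mul_coord_gaussian_zero_one (i j : Fin d) :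
    ∫ e : Vec d, e i * e j ∂(gaussian (0 : Vec d) (1 : Mat d)) = (1 : Mat d) i j := by
  have h := ProbabilityTheory.covariance_eval_multivariateGaussian (μ := (0 : Vec d))
    (PosSemidef.one (n := Fin d) (R := ℝ)) i j
  rw [ProbabilityTheory.multivariateGaussian_zero_one, ← gaussian_zero_one_eq_stdGaussian,
    ProbabilityTheory.covariance_eq_sub (memLp_coord_gaussian_zero_one i)
      (memLp_coord_gaussian_zero_one j)] at h
  simpa [integral_coord_gaussian_zero_one] using h

theorem dotProduct_hess_mulVec {f : Vec d → ℝ} (hf : ContDiff ℝ 2 f) (x v : Vec d) :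
    v.ofLp ⬝ᵥ (hess f x *ᵥ v.ofLp) = fderiv ℝ (fderiv ℝ f) x v v := by
  have hd : DifferentiableAt ℝ (fderiv ℝ f) x :=
    (hf.fderiv_right (m := 1) (by norm_num)).differentiable (by norm_num) x
  have hh (i j : Fin d) : hess f x i j =
      fderiv ℝ (fderiv ℝ f) x (EuclideanSpace.single i 1) (EuclideanSpace.single j 1) := by
    simp only [hess, of_apply]
    rw [fderiv_clm_apply hd (by fun_prop)]
    simp
  have hv : v = ∑ i, v i • EuclideanSpace.single i (1 : ℝ) := by
    simpa using ((EuclideanSpace.basisFun (Fin d) ℝ).sum_repr v).symm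
  conv_rhs => rw [hv]
  simp only [map_sum, map_smul, _root_.sum_apply, _root_.smul_apply,
    dotProduct, mulVec, hh, Finset.mul_sum, smul_eq_mul]
  rw [Finset.sum_comm]
  exact Finset.sum_congr rfl fun i _ => Finset.sum_congr rfl fun j _ => by ring

theorem le_add_fderiv_add_of_hess_lower {U : Vec d → ℝ} {μ : ℝ} (hU : ContDiff ℝ 2 U)
    (h : ∀ x : Vec d, (hess U x - μ • 1).PosSemidef) (x v : Vec d) :
    U x + fderiv ℝ U x v + μ / 2 * ‖v‖ ^ 2 ≤ U (x + v) := by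
  have hq (y : Vec d) : μ * ‖v‖ ^ 2 ≤ fderiv ℝ (fderiv ℝ U) y v v := by
    have := (h y).dotProduct_mulVec_nonneg v.ofLp
    rw [star_trivial, sub_mulVec, dotProduct_sub, dotProduct_hess_mulVec hU, smul_mulVec,
      one_mulVec, dotProduct_smul, EuclideanSpace.norm_sq_eq] at *
    simpa [dotProduct, ← pow_two] using this
  have hl (t : ℝ) : HasDerivAt (fun t : ℝ => x + t • v) v t := by
    simpa using ((hasDerivAt_id t).smul_const v).const_add x
  have hg (t : ℝ) : HasDerivAt (fun t : ℝ => U (x + t • v) - μ / 2 * ‖v‖ ^ 2 * t ^ 2)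
      (fderiv ℝ U (x + t • v) v - μ * ‖v‖ ^ 2 * t) t := by
    have h1 := ((hU.differentiable (by norm_num) (x + t • v)).hasFDerivAt.comp_hasDerivAt t (hl t))
    convert! h1.sub ((hasDerivAt_pow 2 t).const_mul (μ / 2 * ‖v‖ ^ 2)) using 1
    simp
    ring
  have hg' (t : ℝ) : HasDerivAt (fun t : ℝ => fderiv ℝ U (x + t • v) v - μ * ‖v‖ ^ 2 * t)
      (fderiv ℝ (fderiv ℝ U) (x + t • v) v v - μ * ‖v‖ ^ 2) t := by
    have hd : DifferentiableAt ℝ (fderiv ℝ U) (x + t • v) :=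
      (hU.fderiv_right (m := 1) (by norm_num)).differentiable (by norm_num) _
    have h0 := hd.hasFDerivAt.clm_apply (hasFDerivAt_const v (x + t • v))
    have h1 := h0.comp_hasDerivAt t (hl t)
    convert! h1.sub ((hasDerivAt_id t).const_mul (μ * ‖v‖ ^ 2)) using 1
    simp
  have hmono : Monotone fun t : ℝ => fderiv ℝ U (x + t • v) v - μ * ‖v‖ ^ 2 * t :=
    monotone_of_hasDerivAt_nonneg hg' fun t => sub_nonneg.2 (hq _)
  obtain ⟨c, hc, hc'⟩ := exists_hasDerivAt_eq_slope _ _ zero_lt_one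
    (fun t _ => (hg t).continuousAt.continuousWithinAt) fun t _ => hg t
  have := hmono hc.1.le
  simp only [zero_smul, add_zero, mul_zero, sub_zero, one_smul] at hc' this
  norm_num at hc'
  linarith

theorem le_of_hess_upper {U : Vec d → ℝ} {L : ℝ} (hU : ContDiff ℝ 2 U)
    (h : ∀ x : Vec d, (L • (1 : Mat d) - hess U x).PosSemidef) (x v : Vec d) :
    U (x + v) ≤ U x + fderiv ℝ U x v + L / 2 * ‖v‖ ^ 2 := by
  have hn (y : Vec d) : hess (-U) y = -hess U y := by
    ext i j
    have hd : DifferentiableAt ℝ (fderiv ℝ U) y :=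
      (hU.fderiv_right (m := 1) (by norm_num)).differentiable (by norm_num) _
    simp [hess, fderiv_neg, fderiv_fun_neg]
  have := le_add_fderiv_add_of_hess_lower (μ := -L) hU.neg (fun y => by
    have := h y
    change (hess (-U) y - (-L) • 1).PosSemidef
    rw [hn, neg_smul, sub_neg_eq_add, neg_add_eq_sub]
    exact this) x v
  have hneg : fderiv ℝ (fun y => -U y) x = -fderiv ℝ U x := fderiv_fun_neg
  rw [hneg] at this
  simp at this
  linarith

theorem norm_gradient_sq_le {U : Vec d → ℝ} {L : ℝ} (hL : 0 < L) {c : ℝ} (hc : ∀ y, c ≤ U y)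
    (h : ∀ x v : Vec d, U (x + v) ≤ U x + ⟪gradient U x, v⟫ + L / 2 * ‖v‖ ^ 2) (x : Vec d) :
    ‖gradient U x‖ ^ 2 ≤ 2 * L * (U x - c) := by
  have h1 := (hc _).trans (h x (-(L⁻¹ • gradient U x)))
  rw [inner_neg_right, inner_smul_right, real_inner_self_eq_norm_sq, norm_neg, norm_smul,
    Real.norm_of_nonneg (by positivity)] at h1
  have h2 : c ≤ U x - ‖gradient U x‖ ^ 2 / (2 * L) := by
    refine h1.trans_eq ?_
    field_simp
    ring
  have h3 : ‖gradient U x‖ ^ 2 / (2 * L) ≤ U x - c := by linarith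
  rwa [div_le_iff₀' (by positivity)] at h3

theorem matVec_apply (A : Mat d) (x : Vec d) (i : Fin d) :
    matVec A x i = ∑ j, A i j * x j := rfl

theorem memLp_matVec_add (A : Mat d) (v : Vec d) :
    MemLp (fun e => matVec A e + v) 2 (gaussian (0 : Vec d) (1 : Mat d)) :=
  ((Matrix.toEuclideanCLM (𝕜 := ℝ) A).comp_memLp'
    ProbabilityTheory.IsGaussian.memLp_two_id).add (memLp_const v)

theorem integral_matVec_add (A : Mat d) (v : Vec d) :
    ∫ e, (matVec A e + v) ∂(gaussian (0 : Vec d) (1 : Mat d)) = v := by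
  have h0 : ∫ e, matVec A e ∂(gaussian (0 : Vec d) (1 : Mat d)) = 0 := by
    change ∫ e, Matrix.toEuclideanCLM (𝕜 := ℝ) A e ∂_ = 0
    rw [ContinuousLinearMap.integral_comp_comm _ ProbabilityTheory.IsGaussian.integrable_fun_id]
    simp [gaussian_zero_one_eq_stdGaussian]
  have hA : Integrable (matVec A) (gaussian (0 : Vec d) (1 : Mat d)) := by
    simpa using (memLp_matVec_add A 0).integrable one_le_two
  rw [integral_add hA (integrable_const v), h0]
  simp

theorem integral_matVec_add_mul_coord (A : Mat d) (v : Vec d) (i j : Fin d) :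
    ∫ e : Vec d, (matVec A e + v) i * e j ∂(gaussian (0 : Vec d) (1 : Mat d)) = A i j := by
  have hI (k : Fin d) : Integrable (fun e : Vec d => A i k * (e k * e j))
      (gaussian (0 : Vec d) (1 : Mat d)) :=
    ((memLp_coord_gaussian_zero_one k).integrable_mul
      (memLp_coord_gaussian_zero_one j)).const_mul _
  simp only [PiLp.add_apply, matVec_apply, add_mul, Finset.sum_mul, mul_assoc]
  rw [integral_add (integrable_finsetSum _ fun k _ => hI k)
      (((memLp_coord_gaussian_zero_one j).integrable one_le_two).const_mul _),
    integral_finsetSum _ fun k _ => hI k]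
  simp [integral_const_mul, integral_coord_gaussian_zero_one,
    integral_coord_mul_coord_gaussian_zero_one, one_apply]

theorem integral_inner_matVec_add {G : Vec d → Vec d}
    (hG : MemLp G 2 (gaussian (0 : Vec d) (1 : Mat d))) (A : Mat d) (v : Vec d) :
    ∫ e, ⟪G e, matVec A e + v⟫ ∂(gaussian (0 : Vec d) (1 : Mat d)) =
      ⟪∫ e, G e ∂(gaussian (0 : Vec d) (1 : Mat d)), v⟫ +
        ∑ i, ∑ j, (∫ e, G e i * e j ∂(gaussian (0 : Vec d) (1 : Mat d))) * A i j := by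
  have hI (i j : Fin d) : Integrable (fun e : Vec d => G e i * e j * A i j)
      (gaussian (0 : Vec d) (1 : Mat d)) :=
    ((hG.eval_piLp i).integrable_mul (memLp_coord_gaussian_zero_one j)).mul_const _
  have hv : Integrable (fun e => ⟪G e, v⟫) (gaussian (0 : Vec d) (1 : Mat d)) :=
    (hG.integrable one_le_two).inner_const v
  have hpt (e : Vec d) : ⟪G e, matVec A e + v⟫ =
      ⟪G e, v⟫ + ∑ i, ∑ j, G e i * e j * A i j := by
    rw [inner_add_right, add_comm, PiLp.inner_apply (x := G e) (y := matVec A e)]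
    simp only [matVec_apply, RCLike.inner_apply, conj_trivial, Finset.sum_mul]
    congr 1
    exact Finset.sum_congr rfl fun i _ => Finset.sum_congr rfl fun j _ => by ring
  simp only [hpt]
  rw [integral_add hv (integrable_finsetSum _ fun i _ => integrable_finsetSum _ fun j _ => hI i j),
    integral_finsetSum _ fun i _ => integrable_finsetSum _ fun j _ => hI i j]
  congr 1
  · simp only [real_inner_comm v]
    exact integral_inner (hG.integrable one_le_two) v
  · refine Finset.sum_congr rfl fun i _ => ?_
    rw [integral_finsetSum _ fun j _ => hI i j]
    exact Finset.sum_congr rfl fun j _ => integral_mul_const _ _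

theorem integral_norm_matVec_add_sq (A : Mat d) (v : Vec d) :
    ∫ e, ‖matVec A e + v‖ ^ 2 ∂(gaussian (0 : Vec d) (1 : Mat d)) = ‖v‖ ^ 2 + frobSq A := by
  simp only [← real_inner_self_eq_norm_sq]
  rw [integral_inner_matVec_add (memLp_matVec_add A v), integral_matVec_add]
  simp only [integral_matVec_add_mul_coord, frobSq, pow_two]

theorem integrable_comp_of_abs_le_quadratic {Ω : Type*} [MeasurableSpace Ω] {P : Measure Ω}
    [IsFiniteMeasure P] {U : Vec d → ℝ} (hU : Continuous U) {a b c : ℝ}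
    (h : ∀ x, |U x| ≤ a + b * ‖x‖ + c * ‖x‖ ^ 2) {X : Ω → Vec d} (hX : MemLp X 2 P) :
    Integrable (fun ω => U (X ω)) P :=
  Integrable.mono' (((integrable_const a).add ((hX.integrable one_le_two).norm.const_mul b)).add
    (hX.integrable_norm_pow (by norm_num) |>.const_mul c))
    (hU.comp_aestronglyMeasurable hX.aestronglyMeasurable) (.of_forall fun ω => h (X ω))

theorem continuous_gradient {U : Vec d → ℝ} (hU : ContDiff ℝ 1 U) : Continuous (gradient U) :=
  (InnerProductSpace.toDual ℝ (Vec d)).symm.continuous.comp (hU.continuous_fderiv (by norm_num))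

theorem memLp_gradient_comp {Ω : Type*} [MeasurableSpace Ω] {P : Measure Ω}
    [IsFiniteMeasure P] {U : Vec d → ℝ} (hU : ContDiff ℝ 1 U) {K c : ℝ}
    (h : ∀ x, ‖gradient U x‖ ^ 2 ≤ K * (U x - c)) {X : Ω → Vec d} (hX : MemLp X 2 P)
    (hUX : Integrable (fun ω => U (X ω)) P) :
    MemLp (fun ω => gradient U (X ω)) 2 P := by
  have hm := (continuous_gradient hU).comp_aestronglyMeasurable hX.aestronglyMeasurable
  refine (memLp_two_iff_integrable_sq_norm hm).2 ?_
  refine Integrable.mono' ((hUX.sub (integrable_const c)).const_mul K) (hm.norm.pow 2)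
    (.of_forall fun ω => ?_)
  rw [Real.norm_of_nonneg (by positivity)]
  exact h (X ω)

/-- **Coercivity of the parameter gradient of the energy** (Lemma 3.8).  If
`λ_* = (m_*, C_*) ∈ Λ` minimizes the free energy `F` over `Λ`, then for every
`λ = (m,C) ∈ Λ`:
`⟨∇ℰ(λ) − ∇ℰ(λ_*), λ − λ_*⟩ ≥ (μ/2)‖λ − λ_*‖² + (ℰ(λ) − ℰ(λ_*) − ⟨∇ℰ(λ_*), λ − λ_*⟩)`,
where the inner product on parameters is `⟨(m,C),(m',C')⟩ = ⟨m,m'⟩ + tr(CᵀC')`. -/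
theorem param_gradient_coercivity
    (d : ℕ) (hd : 0 < d) (U : Vec d → ℝ) (μ L : ℝ) (hμ : 0 < μ) (hμL : μ ≤ L)
    (hU : ContDiff ℝ 2 U)
    (hconv : ∀ x : Vec d,
      (hess U x - μ • 1).PosSemidef ∧ ((L • (1 : Mat d)) - hess U x).PosSemidef)
    (mstar : Vec d) (Cstar : Mat d) (hstar : memLambda mstar Cstar)
    (hmin : ∀ (m : Vec d) (C : Mat d), memLambda m C →
      paramF U mstar Cstar ≤ paramF U m C) :
    ∀ (m : Vec d) (C : Mat d), memLambda m C →
      ⟪paramGradM U m C - paramGradM U mstar Cstar, m - mstar⟫ +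
          ((paramGradC U m C - paramGradC U mstar Cstar)ᵀ * (C - Cstar)).trace
        ≥ (μ / 2) * (‖m - mstar‖ ^ 2 + frobSq (C - Cstar)) +
          (energyP U m C - energyP U mstar Cstar
            - (⟪paramGradM U mstar Cstar, m - mstar⟫ +
                ((paramGradC U mstar Cstar)ᵀ * (C - Cstar)).trace)) := by
  intro m C _
  have hL : 0 < L := hμ.trans_le hμL
  have hgrad (x v : Vec d) : fderiv ℝ U x v = ⟪gradient U x, v⟫ := by
    rw [gradient, InnerProductSpace.toDual_symm_apply]
  have hlow (x v : Vec d) : U x + ⟪gradient U x, v⟫ + μ / 2 * ‖v‖ ^ 2 ≤ U (x + v) :=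
    hgrad x v ▸ le_add_fderiv_add_of_hess_lower hU (fun y => (hconv y).1) x v
  have hupp (x v : Vec d) : U (x + v) ≤ U x + ⟪gradient U x, v⟫ + L / 2 * ‖v‖ ^ 2 :=
    hgrad x v ▸ le_of_hess_upper hU (fun y => (hconv y).2) x v
  have habs (x : Vec d) : |U x| ≤ |U 0| + ‖gradient U 0‖ * ‖x‖ + L / 2 * ‖x‖ ^ 2 := by
    have h1 := hlow 0 x
    have h2 := hupp 0 x
    have h3 := abs_le.1 (abs_real_inner_le_norm (gradient U 0) x)
    have h4 : 0 ≤ μ / 2 * ‖x‖ ^ 2 := by positivity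
    have h5 : 0 ≤ L / 2 * ‖x‖ ^ 2 := by positivity
    rw [zero_add] at h1 h2
    exact abs_le.2 ⟨by linarith [neg_abs_le (U 0)], by linarith [le_abs_self (U 0)]⟩
  have hbdd (x : Vec d) : U 0 - ‖gradient U 0‖ ^ 2 / (2 * μ) ≤ U x := by
    have h1 := hlow 0 x
    have h3 := abs_le.1 (abs_real_inner_le_norm (gradient U 0) x)
    have h4 : ‖gradient U 0‖ * ‖x‖ - μ / 2 * ‖x‖ ^ 2 ≤ ‖gradient U 0‖ ^ 2 / (2 * μ) := by
      rw [le_div_iff₀ (by positivity)]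
      nlinarith [sq_nonneg (‖gradient U 0‖ - μ * ‖x‖)]
    rw [zero_add] at h1
    linarith
  have hUi (m : Vec d) (C : Mat d) :
      Integrable (fun e => U (matVec C e + m)) (gaussian (0 : Vec d) (1 : Mat d)) :=
    integrable_comp_of_abs_le_quadratic hU.continuous habs (memLp_matVec_add C m)
  have hG : MemLp (fun e => gradient U (matVec C e + m)) 2 (gaussian (0 : Vec d) (1 : Mat d)) :=
    memLp_gradient_comp (hU.of_le (by norm_num)) (norm_gradient_sq_le hL hbdd hupp)
      (memLp_matVec_add C m) (hUi m C)
  have hZ := memLp_matVec_add (C - Cstar) (m - mstar)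
  have hpt (e : Vec d) : U (matVec C e + m) -
      ⟪gradient U (matVec C e + m), matVec (C - Cstar) e + (m - mstar)⟫ +
      μ / 2 * ‖matVec (C - Cstar) e + (m - mstar)‖ ^ 2 ≤ U (matVec Cstar e + mstar) := by
    have h := hlow (matVec C e + m) (-(matVec (C - Cstar) e + (m - mstar)))
    have hsub : matVec C e + m + -(matVec (C - Cstar) e + (m - mstar)) =
        matVec Cstar e + mstar := by
      have : matVec (C - Cstar) e = matVec C e - matVec Cstar e := by
        simp [matVec, sub_mulVec]
      rw [this]
      abel
    rwa [hsub, inner_neg_right, norm_neg, ← sub_eq_add_neg] at h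
  have hIinner : Integrable (fun e => ⟪gradient U (matVec C e + m),
      matVec (C - Cstar) e + (m - mstar)⟫) (gaussian (0 : Vec d) (1 : Mat d)) :=
    (hG.norm.integrable_mul hZ.norm).mono' (hG.1.inner hZ.1)
      (.of_forall fun _ => norm_inner_le_norm _ _)
  have hInorm : Integrable (fun e => μ / 2 * ‖matVec (C - Cstar) e + (m - mstar)‖ ^ 2)
      (gaussian (0 : Vec d) (1 : Mat d)) :=
    (hZ.integrable_norm_pow (by norm_num)).const_mul _
  have hint := integral_mono (((hUi m C).sub hIinner).add hInorm) (hUi mstar Cstar) hpt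
  have htr : ((paramGradC U m C)ᵀ * (C - Cstar)).trace =
      ∑ i, ∑ j, (∫ e, gradient U (matVec C e + m) i * e j ∂(gaussian (0 : Vec d) (1 : Mat d))) *
        (C - Cstar) i j := by
    rw [Finset.sum_comm]
    rfl
  rw [integral_add' ((hUi m C).sub hIinner) hInorm, integral_sub' (hUi m C) hIinner,
    integral_const_mul, integral_norm_matVec_add_sq, integral_inner_matVec_add hG, ← htr] at hint
  change energyP U m C - (⟪paramGradM U m C, m - mstar⟫ + _) + _ ≤ energyP U mstar Cstar at hint
  rw [inner_sub_left, transpose_sub, sub_mul, trace_sub]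
  linarith
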